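/- Let b, T > 0, let φ : [-b,0] → ℝ be a bounded measurable function with φ(0) > 0, let f : ℝ → ℝ be bounded measurable, let J ⊆ ℝ, and let g : J × ℝ → ℝ be bounded measurable such that for some constant α₀ > -1 one has g(z,x) ≥ α₀ for all z ∈ J and x ∈ ℝ. Fix finitely many jump times 0 < τ₁ < τ₂ < … < τ_m ≤ T and marks z₁, …, z_m ∈ J. Then there exists exactly one measurable function S : [-b,T] → ℝ such that S(t) = φ(t) for t ∈ [-b,0], S has a left limit S(τᵢ−) at each τᵢ, and for every t ∈ [0,T], S(t) = φ(0) + ∫₀ᵗ f(S(u−b)) S(u) du + ∑_{i : τᵢ ≤ t} g(zᵢ, S(τᵢ−b)) · S(τᵢ−). Moreover, this unique solution satisfies S(t) > 0 for every t ∈ [0,T]. -/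

import Mathlib

open MeasureTheory Filter Set

/-- Pathwise solution of the delayed jump equation
`dS(t) = f(S(t-b)) S(t) dt + ∫_J g(z, S(t-b)) S(t-) N(dt,dz)`
on `[0,T]` with initial segment `φ` on `[-b,0]`, where the driving Poisson random
measure has atoms at times `τ i` with marks `z i`.  `Sm i` is the left limit
`S(τ i −)`. -/
def IsPathSolution (b T : ℝ) (φ f : ℝ → ℝ) (g : ℝ → ℝ → ℝ)
    (m : ℕ) (τ z : Fin m → ℝ) (S : ℝ → ℝ) : Prop :=
  (∀ t ∈ Set.Icc (-b) (0 : ℝ), S t = φ t) ∧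
  ∃ Sm : Fin m → ℝ,
    (∀ i, Filter.Tendsto S (nhdsWithin (τ i) (Set.Iio (τ i))) (nhds (Sm i))) ∧
    ∀ t ∈ Set.Icc (0 : ℝ) T,
      S t = φ 0 + (∫ u in (0 : ℝ)..t, f (S (u - b)) * S u)
        + ∑ i ∈ Finset.univ.filter (fun i => τ i ≤ t), g (z i) (S (τ i - b)) * Sm i


lemma aux_intble {h : ℝ → ℝ} (hm : Measurable h) {K : ℝ} {s t : ℝ}
    (hK : ∀ u ∈ Set.uIoc s t, |h u| ≤ K) : IntervalIntegrable h volume s t := by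
  refine (intervalIntegrable_const (c := K)).mono_fun hm.aestronglyMeasurable ?_
  refine (ae_restrict_iff' measurableSet_uIoc).2 (Eventually.of_forall fun u hu => ?_)
  exact (hK u hu).trans (le_abs_self K)

lemma aux_prim_cont {a : ℝ → ℝ} (ha : Measurable a) {K : ℝ} (hK : ∀ u, |a u| ≤ K) :
    Continuous fun t => ∫ u in (0:ℝ)..t, a u :=
  intervalIntegral.continuous_primitive (fun _ _ => aux_intble ha (fun u _ => hK u)) 0

lemma aux_exp_int {a : ℝ → ℝ} (ha : Measurable a) {K : ℝ} (hK : ∀ u, |a u| ≤ K) (s t : ℝ) :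
    ∫ u in s..t, a u * Real.exp (∫ v in (0:ℝ)..u, a v)
      = Real.exp (∫ v in (0:ℝ)..t, a v) - Real.exp (∫ v in (0:ℝ)..s, a v) := by
  have hi : ∀ s t, IntervalIntegrable a volume s t := fun s t => aux_intble ha (fun u _ => hK u)
  have hc := aux_prim_cont ha hK
  set A : ℝ → ℝ := fun t => ∫ u in (0:ℝ)..t, a u with hA
  have hK0 : 0 ≤ K := (abs_nonneg _).trans (hK 0)
  have hAl : LipschitzWith K.toNNReal A := by
    refine LipschitzWith.of_dist_le_mul fun x y => ?_
    rw [Real.coe_toNNReal _ hK0, Real.dist_eq, Real.dist_eq, hA]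
    simp only
    rw [intervalIntegral.integral_interval_sub_left (hi _ _) (hi _ _)]
    rw [← Real.norm_eq_abs]
    exact intervalIntegral.norm_integral_le_of_norm_le_const (f := a) (C := K) (fun u _ => hK u)
  obtain ⟨M, hM⟩ := (isCompact_uIcc (a := s) (b := t)).exists_bound_of_continuousOn hc.continuousOn
  obtain ⟨L, hL⟩ := (Real.contDiff_exp (n := 1)).contDiffOn.exists_lipschitzOnWith (by simp)
    (convex_Icc (-M) M) isCompact_Icc
  have hlip : LipschitzOnWith (L * K.toNNReal) (Real.exp ∘ A) (Set.uIcc s t) :=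
    hL.comp hAl.lipschitzOnWith (fun x hx => abs_le.1 (hM x hx))
  have h1 := hlip.absolutelyContinuousOnInterval.integral_deriv_eq_sub
  refine Eq.trans ?_ h1
  have hloc : LocallyIntegrable a volume := by
    refine (locallyIntegrable_const K).mono ha.aestronglyMeasurable ?_
    exact Eventually.of_forall fun u => (hK u).trans (le_abs_self K)
  apply intervalIntegral.integral_congr_ae
  filter_upwards [LocallyIntegrable.ae_hasDerivAt_integral hloc] with x hx _
  have := (hx 0).exp
  rw [show deriv (Real.exp ∘ A) x = _ from this.deriv]
  ring

lemma aux_gronwall {X : ℝ → ℝ} {C K r : ℝ} (hC : 0 ≤ C) (hK : 0 ≤ K) (hr : 0 ≤ r)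
    (hX : IntervalIntegrable X volume 0 r)
    (h : ∀ t ∈ Set.Icc (0:ℝ) r, |X t| ≤ C + K * ∫ u in (0:ℝ)..t, |X u|) :
    ∀ t ∈ Set.Icc (0:ℝ) r, |X t| ≤ C * Real.exp (K * t) := by
  have hi : Integrable (Set.indicator (Set.Ioc 0 r) fun u => |X u|) volume := by
    rw [integrable_indicator_iff measurableSet_Ioc]
    exact ((intervalIntegrable_iff_integrableOn_Ioc_of_le hr).1 hX).abs
  set v := Set.indicator (Set.Ioc 0 r) fun u => |X u| with hv
  have hv0 : ∀ u, 0 ≤ v u := fun u => Set.indicator_nonneg (fun _ _ => abs_nonneg _) u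
  have hvX : ∀ t ∈ Set.Icc (0:ℝ) r, ∫ u in (0:ℝ)..t, |X u| = ∫ u in (0:ℝ)..t, v u := by
    intro t ht
    apply intervalIntegral.integral_congr_ae
    refine Eventually.of_forall fun u hu => ?_
    rw [Set.uIoc_of_le ht.1] at hu
    rw [hv, Set.indicator_of_mem (show u ∈ Set.Ioc 0 r from ⟨hu.1, hu.2.trans ht.2⟩)]
  set w : ℝ → ℝ := fun t => C + K * ∫ u in (0:ℝ)..t, v u with hw
  have hwc : Continuous w := by
    have := intervalIntegral.continuous_primitive (fun a b => hi.intervalIntegrable (a := a) (b := b)) 0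
    fun_prop
  have hXw : ∀ t ∈ Set.Icc (0:ℝ) r, |X t| ≤ w t := by
    intro t ht; rw [hw]; simp only; rw [← hvX t ht]; exact h t ht
  have hw0 : ∀ t, 0 ≤ t → 0 ≤ w t := fun t ht =>
    add_nonneg hC (mul_nonneg hK (intervalIntegral.integral_nonneg ht (fun u _ => hv0 u)))
  set H : ℝ → ℝ := fun t => C + K * ∫ u in (0:ℝ)..t, w u with hH
  have hHd : ∀ t, HasDerivAt H (K * w t) t := fun t =>
    ((hwc.integral_hasStrictDerivAt 0 t).hasDerivAt.const_mul K).const_add C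
  have hwH : ∀ t ∈ Set.Icc (0:ℝ) r, w t ≤ H t := by
    intro t ht
    simp only [hw, hH]
    gcongr
    rw [← hvX t ht]
    apply intervalIntegral.integral_mono_on ht.1
    · exact (hX.mono_set (by rw [Set.uIcc_of_le ht.1, Set.uIcc_of_le hr]; exact Set.Icc_subset_Icc_right ht.2)).abs
    · exact hwc.intervalIntegrable _ _
    · intro u hu; exact hXw u ⟨hu.1, hu.2.trans ht.2⟩
  have key := norm_le_gronwallBound_of_norm_deriv_right_le (f := H) (f' := fun t => K * w t)
    (δ := C) (K := K) (ε := 0) (a := 0) (b := r)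
    (fun t _ => (hHd t).continuousAt.continuousWithinAt)
    (fun t _ => (hHd t).hasDerivWithinAt) (by simp [hH, abs_of_nonneg hC])
    (by
      intro t ht
      have h1 := hw0 t ht.1
      have h2 := hwH t ⟨ht.1, ht.2.le⟩
      rw [Real.norm_of_nonneg (mul_nonneg hK h1), Real.norm_of_nonneg (h1.trans h2), add_zero]
      gcongr)
  intro t ht
  have := key t ht
  rw [gronwallBound_ε0, sub_zero] at this
  exact (hXw t ht).trans ((hwH t ht).trans ((le_abs_self _).trans this))

lemma aux_bdd {a X s : ℝ → ℝ} {C K T : ℝ} (hK : ∀ u, |a u| ≤ K)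
    (hs : ∀ t ∈ Set.Icc (0:ℝ) T, |s t| ≤ C)
    (h : ∀ t ∈ Set.Icc (0:ℝ) T, X t = s t + ∫ u in (0:ℝ)..t, a u * X u) :
    ∃ B, ∀ t ∈ Set.Icc (0:ℝ) T, |X t| ≤ B := by
  have hK0 : 0 ≤ K := (abs_nonneg _).trans (hK 0)
  refine ⟨C + T * ((K * C) * Real.exp (K * T)), fun t ht => ?_⟩
  have hC : 0 ≤ C := (abs_nonneg _).trans (hs t ht)
  have hT : 0 ≤ T := ht.1.trans ht.2
  by_cases hi : IntervalIntegrable (fun u => a u * X u) volume 0 t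
  · have hbd : ∀ r ∈ Set.Icc (0:ℝ) t, |∫ u in (0:ℝ)..r, a u * X u| ≤ ∫ u in (0:ℝ)..r, |a u * X u| :=
      fun r hr => intervalIntegral.abs_integral_le_integral_abs hr.1
    have hg := aux_gronwall (C := K * C) (mul_nonneg hK0 hC) hK0 ht.1 hi (by
      intro r hr
      rw [abs_mul, h r ⟨hr.1, hr.2.trans ht.2⟩, ← mul_add]
      have h1 := abs_add_le (s r) (∫ u in (0:ℝ)..r, a u * X u)
      have h2 := hs r ⟨hr.1, hr.2.trans ht.2⟩
      have h3 := hbd r hr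
      exact mul_le_mul (hK r) (by linarith) (abs_nonneg _) hK0)
    rw [h t ht]
    refine (abs_add_le _ _).trans (add_le_add (hs t ht) ?_)
    have : ‖∫ u in (0:ℝ)..t, a u * X u‖ ≤ (K * C) * Real.exp (K * T) * |t - 0| := by
      apply intervalIntegral.norm_integral_le_of_norm_le_const
      intro u hu
      rw [Set.uIoc_of_le ht.1] at hu
      refine (hg u ⟨hu.1.le, hu.2⟩).trans ?_
      have := hu.2.trans ht.2
      gcongr
    refine this.trans ?_
    rw [sub_zero, abs_of_nonneg ht.1, mul_comm]
    have := ht.2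
    gcongr
  · rw [h t ht, intervalIntegral.integral_undef hi, add_zero]
    refine (hs t ht).trans (le_add_of_nonneg_right (by positivity))

lemma aux_zero {a D : ℝ → ℝ} {K r : ℝ} (hr : 0 ≤ r) (hK : ∀ u, |a u| ≤ K)
    (hi : IntervalIntegrable D volume 0 r)
    (h : ∀ t ∈ Set.Icc (0:ℝ) r, D t = ∫ u in (0:ℝ)..t, a u * D u) :
    ∀ t ∈ Set.Icc (0:ℝ) r, D t = 0 := by
  have hK0 : 0 ≤ K := (abs_nonneg _).trans (hK 0)
  intro t ht
  have := aux_gronwall le_rfl hK0 hr hi (by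
    intro t ht
    have hit : IntervalIntegrable D volume 0 t := hi.mono_set (by
      rw [Set.uIcc_of_le ht.1, Set.uIcc_of_le hr]; exact Set.Icc_subset_Icc_right ht.2)
    rw [h t ht, zero_add, ← intervalIntegral.integral_const_mul]
    rw [← Real.norm_eq_abs]
    refine intervalIntegral.norm_integral_le_of_norm_le ht.1 ?_ (hit.abs.const_mul K)
    refine Eventually.of_forall fun u _ => ?_
    rw [Real.norm_eq_abs, abs_mul]
    exact mul_le_mul_of_nonneg_right (hK u) (abs_nonneg _)) t ht
  simpa using this

lemma aux_int_ite {h : ℝ → ℝ} (hi : ∀ s t, IntervalIntegrable h volume s t) {c t : ℝ}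
    (hc : 0 < c) (ht : 0 ≤ t) :
    IntervalIntegrable (fun u => if c ≤ u then h u else 0) volume 0 t ∧
    ∫ u in (0:ℝ)..t, (if c ≤ u then h u else 0) = if c ≤ t then ∫ u in c..t, h u else 0 := by
  have hI : ∀ s t, IntervalIntegrable (fun u => if c ≤ u then h u else 0) volume s t := by
    intro s t
    have : (fun u => if c ≤ u then h u else 0) = Set.indicator (Set.Ici c) h := by
      ext u; simp [Set.indicator_apply]
    rw [this]
    exact ⟨(hi s t).1.indicator measurableSet_Ici, (hi s t).2.indicator measurableSet_Ici⟩
  refine ⟨hI _ _, ?_⟩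
  have hz : ∀ r, 0 ≤ r → r ≤ c → ∫ u in (0:ℝ)..r, (if c ≤ u then h u else 0) = 0 := by
    intro r hr hrc
    apply intervalIntegral.integral_zero_ae
    have : ∀ᵐ x : ℝ, x ≠ c := by simp [ae_iff, measure_singleton]
    filter_upwards [this] with u hu hu2
    rw [Set.uIoc_of_le hr] at hu2
    rw [if_neg]
    exact not_le.2 (lt_of_le_of_ne (hu2.2.trans hrc) hu)
  split_ifs with hct
  · rw [← intervalIntegral.integral_add_adjacent_intervals (hI 0 c) (hI c t), hz c hc.le le_rfl,
      zero_add]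
    apply intervalIntegral.integral_congr
    intro u hu
    rw [Set.uIcc_of_le hct] at hu
    simp [hu.1]
  · exact hz t ht (not_le.1 hct).le

/-- The explicit solution of the linear equation with coefficient `a` and jump sizes `γ`. -/
noncomputable def explSol (x0 : ℝ) (a : ℝ → ℝ) {m : ℕ} (τ γ : Fin m → ℝ) (t : ℝ) : ℝ :=
  x0 * Real.exp (∫ u in (0:ℝ)..t, a u) * ∏ i ∈ Finset.univ.filter (fun i => τ i ≤ t), (1 + γ i)

lemma explSol_meas (x0 : ℝ) {a : ℝ → ℝ} (ha : Measurable a) {K : ℝ} (hK : ∀ u, |a u| ≤ K)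
    {m : ℕ} (τ γ : Fin m → ℝ) : Measurable (explSol x0 a τ γ) := by
  unfold explSol
  simp_rw [Finset.prod_filter]
  have := (aux_prim_cont ha hK).measurable
  refine (measurable_const.mul this.exp).mul (Finset.measurable_fun_prod _ fun i _ => ?_)
  exact Measurable.ite measurableSet_Ici measurable_const measurable_const

lemma explSol_sum (x0 : ℝ) (a : ℝ → ℝ) {m : ℕ} {τ : Fin m → ℝ} (hτ : StrictMono τ)
    (γ : Fin m → ℝ) (t : ℝ) :
    explSol x0 a τ γ t = x0 * Real.exp (∫ u in (0:ℝ)..t, a u) +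
      ∑ i, (x0 * γ i * ∏ j ∈ Finset.univ.filter (fun j => j < i), (1 + γ j)) *
        (if τ i ≤ t then Real.exp (∫ u in (0:ℝ)..t, a u) else 0) := by
  unfold explSol
  rw [Finset.prod_one_add_ordered, mul_add, mul_one, Finset.sum_filter, Finset.mul_sum]
  congr 1
  refine Finset.sum_congr rfl fun i _ => ?_
  split_ifs with h
  · have : (Finset.univ.filter (fun i => τ i ≤ t)).filter (fun j => j < i)
        = Finset.univ.filter (fun j => j < i) := by
      ext j
      simp only [Finset.mem_filter, Finset.mem_univ, true_and, and_iff_right_iff_imp]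
      exact fun hj => (hτ hj).le.trans h
    rw [this]; ring
  · simp

lemma explSol_left (x0 : ℝ) {a : ℝ → ℝ} (ha : Measurable a) {K : ℝ} (hK : ∀ u, |a u| ≤ K)
    {m : ℕ} {τ : Fin m → ℝ} (hτ : StrictMono τ) (γ : Fin m → ℝ) (i : Fin m) :
    Tendsto (explSol x0 a τ γ) (nhdsWithin (τ i) (Set.Iio (τ i)))
      (nhds (x0 * Real.exp (∫ u in (0:ℝ)..(τ i), a u) *
        ∏ j ∈ Finset.univ.filter (fun j => j < i), (1 + γ j))) := by
  unfold explSol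
  have hc := aux_prim_cont ha hK
  have hc' : Continuous fun t => x0 * Real.exp (∫ u in (0:ℝ)..t, a u) := by fun_prop
  refine Tendsto.mul (hc'.continuousAt.tendsto.mono_left nhdsWithin_le_nhds) ?_
  simp_rw [Finset.prod_filter]
  refine tendsto_finsetProd _ fun j _ => ?_
  apply tendsto_const_nhds.congr'
  by_cases hj : j < i
  · have h1 : ∀ᶠ t in nhdsWithin (τ i) (Set.Iio (τ i)), τ j < t :=
      nhdsWithin_le_nhds (lt_mem_nhds (hτ hj))
    filter_upwards [h1] with t ht
    simp [hj, ht.le]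
  · filter_upwards [self_mem_nhdsWithin] with t ht
    have : ¬ τ j ≤ t := not_le.2 (lt_of_lt_of_le ht (hτ.monotone (not_lt.1 hj)))
    simp [hj, this]

lemma explSol_eq (x0 : ℝ) {a : ℝ → ℝ} (ha : Measurable a) {K : ℝ} (hK : ∀ u, |a u| ≤ K)
    {m : ℕ} {τ : Fin m → ℝ} (hτ : StrictMono τ) (hτ0 : ∀ i, 0 < τ i) (γ : Fin m → ℝ)
    {t : ℝ} (ht : 0 ≤ t) :
    explSol x0 a τ γ t = x0 + (∫ u in (0:ℝ)..t, a u * explSol x0 a τ γ u)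
      + ∑ i ∈ Finset.univ.filter (fun i => τ i ≤ t), γ i *
        (x0 * Real.exp (∫ u in (0:ℝ)..(τ i), a u) *
        ∏ j ∈ Finset.univ.filter (fun j => j < i), (1 + γ j)) := by
  have hc := aux_prim_cont ha hK
  have hc' : Continuous fun t => Real.exp (∫ u in (0:ℝ)..t, a u) := by fun_prop
  have hi : ∀ s t, IntervalIntegrable (fun u => a u * Real.exp (∫ v in (0:ℝ)..u, a v)) volume s t :=
    fun s t => (aux_intble ha (fun u _ => hK u)).mul_continuousOn hc'.continuousOn
  have hfun : (fun u => a u * explSol x0 a τ γ u) = fun u =>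
      x0 * (a u * Real.exp (∫ v in (0:ℝ)..u, a v)) +
      ∑ i, (x0 * γ i * ∏ j ∈ Finset.univ.filter (fun j => j < i), (1 + γ j)) *
        (if τ i ≤ u then a u * Real.exp (∫ v in (0:ℝ)..u, a v) else 0) := by
    ext u
    rw [explSol_sum x0 a hτ γ u, mul_add, Finset.mul_sum]
    congr 1
    · ring
    · refine Finset.sum_congr rfl fun i _ => ?_
      split_ifs <;> ring
  rw [hfun, intervalIntegral.integral_add ((hi 0 t).const_mul _)
    (by
      have := IntervalIntegrable.sum (μ := volume) (a := 0) (b := t) Finset.univ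
        (f := fun i u => (x0 * γ i * ∏ j ∈ Finset.univ.filter (fun j => j < i), (1 + γ j)) *
        (if τ i ≤ u then a u * Real.exp (∫ v in (0:ℝ)..u, a v) else 0))
        (fun i _ => (aux_int_ite hi (hτ0 i) ht).1.const_mul _)
      simpa only [Finset.sum_fn] using this),
    intervalIntegral.integral_finsetSum
      (fun i _ => (aux_int_ite hi (hτ0 i) ht).1.const_mul _), explSol_sum x0 a hτ γ t]
  simp_rw [intervalIntegral.integral_const_mul]
  rw [aux_exp_int ha hK, intervalIntegral.integral_same, Real.exp_zero, Finset.sum_filter,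
    add_assoc, add_assoc, ← Finset.sum_add_distrib, ← add_assoc]
  congr 1
  · ring
  · refine Finset.sum_congr rfl fun i _ => ?_
    rw [(aux_int_ite hi (hτ0 i) ht).2, aux_exp_int ha hK]
    split_ifs <;> ring

lemma lin_unique {a X Y : ℝ → ℝ} (ha : Measurable a) {K : ℝ} (hK : ∀ u, |a u| ≤ K)
    (hX : Measurable X) (hY : Measurable Y)
    {m : ℕ} {τ : Fin m → ℝ} (hτ : StrictMono τ) (hτ0 : ∀ i, 0 < τ i) (γ : Fin m → ℝ)
    {T x0 : ℝ} (hT : 0 < T) (hτT : ∀ i, τ i ≤ T) (Xm Ym : Fin m → ℝ)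
    (hXm : ∀ i, Tendsto X (nhdsWithin (τ i) (Set.Iio (τ i))) (nhds (Xm i)))
    (hYm : ∀ i, Tendsto Y (nhdsWithin (τ i) (Set.Iio (τ i))) (nhds (Ym i)))
    (hXe : ∀ t ∈ Set.Icc (0 : ℝ) T, X t = x0 + (∫ u in (0 : ℝ)..t, a u * X u)
        + ∑ i ∈ Finset.univ.filter (fun i => τ i ≤ t), γ i * Xm i)
    (hYe : ∀ t ∈ Set.Icc (0 : ℝ) T, Y t = x0 + (∫ u in (0 : ℝ)..t, a u * Y u)
        + ∑ i ∈ Finset.univ.filter (fun i => τ i ≤ t), γ i * Ym i) :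
    ∀ t ∈ Set.Icc (0 : ℝ) T, X t = Y t := by
  have bd : ∀ (Z : ℝ → ℝ) (Zm : Fin m → ℝ), Measurable Z →
      (∀ t ∈ Set.Icc (0 : ℝ) T, Z t = x0 + (∫ u in (0 : ℝ)..t, a u * Z u)
        + ∑ i ∈ Finset.univ.filter (fun i => τ i ≤ t), γ i * Zm i) →
      ∀ t ∈ Set.Icc (0 : ℝ) T, IntervalIntegrable Z volume 0 t := by
    intro Z Zm hZ hZe t ht
    obtain ⟨B, hB⟩ := aux_bdd (a := a) (X := Z) (T := T) (C := |x0| + ∑ i, |γ i * Zm i|)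
      (s := fun t => x0 + ∑ i ∈ Finset.univ.filter (fun i => τ i ≤ t), γ i * Zm i) hK
      (fun t _ => (abs_add_le _ _).trans (add_le_add le_rfl
        ((Finset.abs_sum_le_sum_abs _ _).trans
          (Finset.sum_le_sum_of_subset_of_nonneg (Finset.filter_subset _ _)
            (fun _ _ _ => abs_nonneg _)))))
      (fun t ht => by rw [hZe t ht]; ring)
    refine aux_intble hZ (K := B) fun u hu => ?_
    rw [Set.uIoc_of_le ht.1] at hu
    exact hB u ⟨hu.1.le, hu.2.trans ht.2⟩
  have iX := bd X Xm hX hXe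
  have iY := bd Y Ym hY hYe
  have hmul : ∀ Z : ℝ → ℝ, ∀ t, IntervalIntegrable Z volume 0 t →
      IntervalIntegrable (fun u => a u * Z u) volume 0 t := by
    intro Z t hZ
    refine (hZ.abs.const_mul K).mono_fun
      (ha.aestronglyMeasurable.mul (intervalIntegrable_iff.1 hZ).aestronglyMeasurable) (Eventually.of_forall fun u => ?_)
    have hK0 : 0 ≤ K := (abs_nonneg _).trans (hK 0)
    simp only [norm_mul, Real.norm_eq_abs, abs_abs]
    exact mul_le_mul_of_nonneg_right ((hK u).trans (le_abs_self K)) (abs_nonneg _)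
  have hD : ∀ t ∈ Set.Icc (0 : ℝ) T, X t - Y t = (∫ u in (0 : ℝ)..t, a u * (X u - Y u))
        + ∑ i ∈ Finset.univ.filter (fun i => τ i ≤ t), γ i * (Xm i - Ym i) := by
    intro t ht
    simp_rw [mul_sub]
    rw [intervalIntegral.integral_sub (hmul X t (iX t ht)) (hmul Y t (iY t ht)),
      Finset.sum_sub_distrib, hXe t ht, hYe t ht]
    ring
  have hm : ∀ i, Xm i = Ym i := by
    intro i
    induction i using WellFoundedLT.induction with
    | ind i ih =>
    have hz : ∀ t, 0 ≤ t → t < τ i → X t - Y t = 0 := by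
      intro t ht0 hti
      have htT : t ≤ T := hti.le.trans (hτT i)
      refine aux_zero (a := a) (D := fun t => X t - Y t) ht0 hK
        ((iX t ⟨ht0, htT⟩).sub (iY t ⟨ht0, htT⟩)) ?_ t ⟨ht0, le_rfl⟩
      intro s hs
      rw [hD s ⟨hs.1, hs.2.trans htT⟩, Finset.sum_eq_zero, add_zero]
      intro j hj
      have hj' : τ j ≤ s := (Finset.mem_filter.1 hj).2
      rw [ih j (hτ.lt_iff_lt.1 ((hj'.trans hs.2).trans_lt hti)), sub_self, mul_zero]
    have h1 := (hXm i).sub (hYm i)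
    have h2 : Tendsto (fun t => X t - Y t) (nhdsWithin (τ i) (Set.Iio (τ i))) (nhds 0) := by
      apply tendsto_const_nhds.congr'
      have : ∀ᶠ t in nhdsWithin (τ i) (Set.Iio (τ i)), 0 < t :=
        nhdsWithin_le_nhds (lt_mem_nhds (hτ0 i))
      filter_upwards [this, self_mem_nhdsWithin] with t ht ht2
      exact (hz t ht.le ht2).symm
    exact sub_eq_zero.1 (tendsto_nhds_unique h1 h2)
  intro t ht
  refine sub_eq_zero.1 (aux_zero (a := a) (D := fun t => X t - Y t) ht.1 hK
        ((iX t ht).sub (iY t ht)) ?_ t ⟨ht.1, le_rfl⟩)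
  intro s hs
  rw [hD s ⟨hs.1, hs.2.trans ht.2⟩, Finset.sum_eq_zero, add_zero]
  intro j _
  rw [hm j, sub_self, mul_zero]

/-- One step of the method of steps. -/
noncomputable def stepOp (b : ℝ) (φ f : ℝ → ℝ) (g : ℝ → ℝ → ℝ) {m : ℕ} (τ z : Fin m → ℝ)
    (S : ℝ → ℝ) (t : ℝ) : ℝ :=
  if t ≤ 0 then φ t else
    explSol (φ 0) (fun u => f (S (u - b))) τ (fun i => g (z i) (S (τ i - b))) t

lemma stepOp_congr {b : ℝ} {φ f : ℝ → ℝ} {g : ℝ → ℝ → ℝ} {m : ℕ} {τ z : Fin m → ℝ}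
    (hτ0 : ∀ i, 0 < τ i) {S S' : ℝ → ℝ} {t : ℝ}
    (h : ∀ s, -b ≤ s → s ≤ t - b → S s = S' s) :
    stepOp b φ f g τ z S t = stepOp b φ f g τ z S' t := by
  unfold stepOp
  split_ifs with ht
  · rfl
  · unfold explSol
    congr 1
    · congr 2
      apply intervalIntegral.integral_congr
      intro u hu
      rw [Set.uIcc_of_le (not_le.1 ht).le] at hu
      simp only
      rw [h (u - b) (by linarith [hu.1]) (by linarith [hu.2])]
    · refine Finset.prod_congr rfl fun i hi => ?_
      have hi' : τ i ≤ t := (Finset.mem_filter.1 hi).2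
      simp only
      rw [h (τ i - b) (by linarith [hτ0 i]) (by linarith)]

/-- Existence, uniqueness (on `[-b,T]`) and positivity of the pathwise solution of the
delayed jump equation with finitely many jumps. -/
theorem stmt_0 (b T : ℝ) (hb : 0 < b) (hT : 0 < T)
    (φ : ℝ → ℝ) (hφm : Measurable φ) (hφb : ∃ C, ∀ t ∈ Set.Icc (-b) (0 : ℝ), |φ t| ≤ C)
    (hφ0 : 0 < φ 0)
    (f : ℝ → ℝ) (hfm : Measurable f) (hfb : ∃ C, ∀ x, |f x| ≤ C)
    (J : Set ℝ) (g : ℝ → ℝ → ℝ)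
    (hgm : Measurable fun pr : ℝ × ℝ => g pr.1 pr.2)
    (hgb : ∃ C, ∀ zz x, |g zz x| ≤ C)
    (α₀ : ℝ) (hα₀ : -1 < α₀) (hg : ∀ zz ∈ J, ∀ x : ℝ, α₀ ≤ g zz x)
    (m : ℕ) (τ z : Fin m → ℝ) (hτmono : StrictMono τ)
    (hτpos : ∀ i, 0 < τ i) (hτT : ∀ i, τ i ≤ T) (hz : ∀ i, z i ∈ J) :
    ∃ S : ℝ → ℝ, (Measurable S ∧ IsPathSolution b T φ f g m τ z S) ∧
      (∀ t ∈ Set.Icc (0 : ℝ) T, 0 < S t) ∧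
      (∀ S' : ℝ → ℝ, Measurable S' → IsPathSolution b T φ f g m τ z S' →
        Set.EqOn S' S (Set.Icc (-b) T)) := by
  obtain ⟨K, hK⟩ := hfb
  have am : ∀ S : ℝ → ℝ, Measurable S → Measurable fun u => f (S (u - b)) := fun S hS =>
    hfm.comp (hS.comp (measurable_id.sub_const b))
  have aK : ∀ S : ℝ → ℝ, ∀ u, |f (S (u - b))| ≤ K := fun S u => hK _
  set Φ := stepOp b φ f g τ z with hΦ
  have hmeas : ∀ S, Measurable S → Measurable (Φ S) := fun S hS =>
    Measurable.ite measurableSet_Iic hφm (explSol_meas _ (am S hS) (aK S) _ _)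
  -- the value on `[0, ∞)`
  have hval : ∀ S : ℝ → ℝ, ∀ t, 0 ≤ t → Φ S t =
      explSol (φ 0) (fun u => f (S (u - b))) τ (fun i => g (z i) (S (τ i - b))) t := by
    intro S t ht
    rcases ht.eq_or_lt with rfl | ht
    · have : (Finset.univ.filter fun i => τ i ≤ 0) = ∅ :=
        Finset.filter_eq_empty_iff.2 fun i _ => not_le.2 (hτpos i)
      simp [hΦ, stepOp, explSol, this]
    · simp [hΦ, stepOp, not_le.2 ht]
  -- solutions are fixed points
  have hfix : ∀ S, Measurable S → IsPathSolution b T φ f g m τ z S →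
      ∀ t ∈ Set.Icc (-b) T, S t = Φ S t := by
    rintro S hS ⟨h0, Sm, hSm, hSe⟩ t ht
    by_cases ht0 : t ≤ 0
    · rw [h0 t ⟨ht.1, ht0⟩]; simp [hΦ, stepOp, ht0]
    · have ht0 := (not_le.1 ht0).le
      rw [hval S t ht0]
      exact lin_unique (am S hS) (aK S) hS (explSol_meas _ (am S hS) (aK S) _ _) hτmono hτpos
        (fun i => g (z i) (S (τ i - b))) hT hτT Sm _ hSm
        (fun i => explSol_left _ (am S hS) (aK S) hτmono _ i) hSe
        (fun t ht => explSol_eq _ (am S hS) (aK S) hτmono hτpos _ ht.1) t ⟨ht0, ht.2⟩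
  -- construction
  let I : ℕ → ℝ → ℝ := fun n => Φ^[n] φ
  have hI : ∀ n, I (n + 1) = Φ (I n) := fun n => Function.iterate_succ_apply' Φ n φ
  have hIm : ∀ n, Measurable (I n) := by
    intro n
    induction n with
    | zero => exact hφm
    | succ n ih => rw [hI]; exact hmeas _ ih
  have hIs : ∀ n : ℕ, ∀ t, t ≤ n * b → I (n + 1) t = I n t := by
    intro n
    induction n with
    | zero =>
      intro t ht
      have ht : t ≤ 0 := by simpa using ht
      rw [hI]; simp [hΦ, stepOp, ht, I]
    | succ n ih =>
      intro t ht
      rw [hI (n + 1)]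
      refine Eq.trans ?_ (congrFun (hI n) t).symm
      refine stepOp_congr hτpos fun s _ hs => ih s ?_
      push_cast at ht
      linarith
  obtain ⟨N, hN⟩ := exists_nat_ge (T / b)
  have hNT : T ≤ N * b := (div_le_iff₀ hb).1 hN
  set S := I N with hSdef
  have hS : Measurable S := hIm N
  have hSf : ∀ t ≤ T, S t = Φ S t := fun t ht => by
    rw [← hI N, hIs N t (ht.trans hNT)]
  let Sm : Fin m → ℝ := fun i => (φ 0 * Real.exp (∫ u in (0:ℝ)..(τ i), f (S (u - b))) *
        ∏ j ∈ Finset.univ.filter (fun j => j < i), (1 + g (z j) (S (τ j - b))))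
  refine ⟨S, ⟨hS, ?_, Sm, fun i => ?_, fun t ht => ?_⟩, fun t ht => ?_, fun S' hS' hsol => ?_⟩
  · intro t ht
    rw [hSf t (ht.2.trans hT.le)]; simp [hΦ, stepOp, ht.2]
  · refine (explSol_left (φ 0) (am S hS) (aK S) hτmono
      (fun i => g (z i) (S (τ i - b))) i).congr' ?_
    have : ∀ᶠ t in nhdsWithin (τ i) (Set.Iio (τ i)), 0 < t :=
      nhdsWithin_le_nhds (lt_mem_nhds (hτpos i))
    filter_upwards [this, self_mem_nhdsWithin] with t ht ht2
    rw [hSf t ((le_of_lt ht2).trans (hτT i)), hval S t ht.le]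
  · have hEq : ∫ u in (0:ℝ)..t, f (S (u - b)) * S u = ∫ u in (0:ℝ)..t, f (S (u - b)) *
        explSol (φ 0) (fun u => f (S (u - b))) τ (fun i => g (z i) (S (τ i - b))) u := by
      apply intervalIntegral.integral_congr
      intro u hu
      rw [Set.uIcc_of_le ht.1] at hu
      simp only
      rw [← hval S u hu.1, ← hSf u (hu.2.trans ht.2)]
    rw [hEq, hSf t ht.2, hval S t ht.1]
    exact explSol_eq _ (am S hS) (aK S) hτmono hτpos _ ht.1
  · rw [hSf t ht.2, hval S t ht.1]
    refine mul_pos (mul_pos hφ0 (Real.exp_pos _)) (Finset.prod_pos fun i _ => ?_)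
    linarith [hg (z i) (hz i) (S (τ i - b))]
  · have key : ∀ n : ℕ, ∀ t ∈ Set.Icc (-b) T, t ≤ n * b → S' t = S t := by
      intro n
      induction n with
      | zero =>
        intro t ht ht0
        have ht0 : t ≤ 0 := by simpa using ht0
        rw [hfix S' hS' hsol t ht, hSf t ht.2]; simp [hΦ, stepOp, ht0]
      | succ n ih =>
        intro t ht ht0
        rw [hfix S' hS' hsol t ht, hSf t ht.2]
        push_cast at ht0
        exact stepOp_congr hτpos fun s hs1 hs => ih s ⟨hs1, by linarith [ht.2]⟩ (by linarith)
    exact fun t ht => key N t ht (ht.2.trans hNT)
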